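/- arXiv:0806.0805 — 2 statements merged into one kernel-verified Lean document; each statement's English description precedes it below -/
import Mathlib

section
/- (Corollary 1) For every integer k ≥ 1 and every n ∈ ℤ, ∑_{j=0}^{k+1} (−1)^{binom(j+1,2)} · s^{binom(j,2)} · q^{(n−1)·binom(j,2) − j(j−1)(2j−1)/6} · fibo(k+1, j) · f(n−j, x, s)^k = 0, where fibo(k+1, j) = (∏_{i=1}^{k+1} f(i, x, q^{n−i}·s)) / (∏_{i=1}^{j} f(i, x, q^{n−j}·s) · ∏_{i=1}^{k+1−j} f(i, x, q^{n−i−j}·s)), provided all factors appearing in these denominators are nonzero. -/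
open Finset

variable {K : Type*} [Field K]

noncomputable def qFibPos (q x t : K) : ℕ → K
  | 0 => 0
  | 1 => 1
  | n + 2 => x * qFibPos q x t (n + 1) + q ^ n * t * qFibPos q x t n

noncomputable def qFibNeg (q x t : K) : ℕ → K
  | 0 => 0
  | 1 => q / t
  | m + 2 => (qFibNeg q x t m - x * qFibNeg q x t (m + 1)) * q ^ (m + 2) / t

/-- The Carlitz q-Fibonacci polynomial `f(n, x, t)` for `n : ℤ`, defined by `f 0 = 0`,
`f 1 = 1` and `f n = x * f (n-1) + q^(n-2) * t * f (n-2)`, solved backwards for `n < 0`. -/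
noncomputable def qFib (q x t : K) : ℤ → K
  | Int.ofNat n => qFibPos q x t n
  | Int.negSucc m => qFibNeg q x t (m + 1)

/-- `fibo(k+1, j) = (∏_{i=1}^{k+1} f(i,x,q^{n-i}s)) /
(∏_{i=1}^{j} f(i,x,q^{n-j}s) · ∏_{i=1}^{k+1-j} f(i,x,q^{n-i-j}s))`. -/
noncomputable def fibo (q x s : K) (n : ℤ) (k j : ℕ) : K :=
  (∏ i ∈ Finset.range (k + 1), qFib q x (q ^ (n - (i + 1)) * s) ((i : ℤ) + 1)) /
    ((∏ i ∈ Finset.range j, qFib q x (q ^ (n - j) * s) ((i : ℤ) + 1)) *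
      (∏ i ∈ Finset.range (k + 1 - j), qFib q x (q ^ (n - (i + 1) - j) * s) ((i : ℤ) + 1)))

theorem qFib_nat (q x t : K) (n : ℕ) : qFib q x t (n : ℤ) = qFibPos q x t n := rfl

theorem qFib_neg (q x t : K) (m : ℕ) : qFib q x t (-(m : ℤ)) = qFibNeg q x t m := by
  cases m with
  | zero => simp [qFib_nat q x t 0 |> fun h => by simpa using h, qFibPos, qFibNeg]
  | succ m => rfl

theorem qFib_rec (q x t : K) (hq : q ≠ 0) (ht : t ≠ 0) (n : ℤ) :
    qFib q x t (n + 2) = x * qFib q x t (n + 1) + q ^ n * t * qFib q x t n := by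
  rcases le_or_gt 0 n with h | h
  · obtain ⟨m, rfl⟩ := Int.eq_ofNat_of_zero_le h
    have e1 : (m : ℤ) + 2 = ((m + 2 : ℕ) : ℤ) := by push_cast; ring
    have e2 : (m : ℤ) + 1 = ((m + 1 : ℕ) : ℤ) := by push_cast; ring
    rw [e1, e2, qFib_nat, qFib_nat, qFib_nat, qFibPos, zpow_natCast]
  · rcases eq_or_ne n (-1) with rfl | h1
    · have e1 : (-1 : ℤ) + 2 = ((1 : ℕ) : ℤ) := by norm_num
      have e2 : (-1 : ℤ) + 1 = ((0 : ℕ) : ℤ) := by norm_num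
      have e3 : (-1 : ℤ) = -((1 : ℕ) : ℤ) := by norm_num
      rw [e1, e2, qFib_nat, qFib_nat, e3, qFib_neg]
      simp only [qFibPos, qFibNeg]
      simp
      field_simp
    · obtain ⟨m, hm⟩ := Int.eq_ofNat_of_zero_le (show 0 ≤ -n - 2 by omega)
      have e0 : n = -((m + 2 : ℕ) : ℤ) := by push_cast; omega
      have e1 : n + 2 = -((m : ℕ) : ℤ) := by omega
      have e2 : n + 1 = -((m + 1 : ℕ) : ℤ) := by push_cast; omega
      rw [e1, e2, e0, qFib_neg, qFib_neg, qFib_neg, zpow_neg, zpow_natCast]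
      simp only [qFibNeg]
      field_simp
      ring

/-- Homogeneous Lagrange identity. -/
theorem lagrange_hom {ι : Type*} [DecidableEq ι] (u w : ι → K) (k : ℕ) :
    ∀ (S : Finset ι), S.card = k + 2 →
    (∀ i ∈ S, ∀ j ∈ S, i ≠ j → u i * w j - u j * w i ≠ 0) →
    ∑ j ∈ S, u j ^ k * (∏ i ∈ S.erase j, (u i * w j - u j * w i))⁻¹ = 0 := by
  induction k with
  | zero =>
    intro S hS hd
    obtain ⟨a, b, hab, rfl⟩ := Finset.card_eq_two.mp hS
    have h1 : ({a, b} : Finset ι).erase a = {b} := by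
      ext i; simp only [mem_erase, mem_insert, mem_singleton]; grind
    have h2 : ({a, b} : Finset ι).erase b = {a} := by
      ext i; simp only [mem_erase, mem_insert, mem_singleton]; grind
    rw [Finset.sum_pair hab, h1, h2]
    simp only [prod_singleton, pow_zero, one_mul]
    have : u b * w a - u a * w b = -(u a * w b - u b * w a) := by ring
    rw [this, inv_neg]; ring
  | succ k ih =>
    intro S hS hd
    obtain ⟨a, ha, b, hb, hab⟩ := Finset.one_lt_card.mp (show 1 < S.card by omega)
    have key : ∀ c ∈ S, ∑ j ∈ S, u j ^ k * (u j * w c - u c * w j) *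
        (∏ i ∈ S.erase j, (u i * w j - u j * w i))⁻¹ = 0 := by
      intro c hc
      have h := ih (S.erase c) (by rw [card_erase_of_mem hc]; omega)
        (fun i hi j hj => hd i (mem_of_mem_erase hi) j (mem_of_mem_erase hj))
      rw [← Finset.add_sum_erase S _ hc]
      have : ∀ j ∈ S.erase c, u j ^ k * (u j * w c - u c * w j) *
          (∏ i ∈ S.erase j, (u i * w j - u j * w i))⁻¹ =
          -(u j ^ k * (∏ i ∈ (S.erase c).erase j, (u i * w j - u j * w i))⁻¹) := by
        intro j hj
        have hjc := ne_of_mem_erase hj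
        have hj' := mem_of_mem_erase hj
        have hn := hd c hc j hj' hjc.symm
        rw [← Finset.mul_prod_erase (S.erase j) _ (mem_erase.mpr ⟨hjc.symm, hc⟩),
          Finset.erase_right_comm, mul_inv]
        have e : u j * w c - u c * w j = -(u c * w j - u j * w c) := by ring
        rw [e]
        generalize (∏ i ∈ (S.erase c).erase j, (u i * w j - u j * w i))⁻¹ = Q
        field_simp
      rw [Finset.sum_congr rfl this, Finset.sum_neg_distrib, h]
      ring
    have hn := hd a ha b hb hab
    have ka := key a ha
    have kb := key b hb
    apply (mul_eq_zero.mp _).resolve_left hn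
    have : (u a * w b - u b * w a) * ∑ j ∈ S, u j ^ (k + 1) *
        (∏ i ∈ S.erase j, (u i * w j - u j * w i))⁻¹ =
        u a * (∑ j ∈ S, u j ^ k * (u j * w b - u b * w j) *
        (∏ i ∈ S.erase j, (u i * w j - u j * w i))⁻¹) -
        u b * (∑ j ∈ S, u j ^ k * (u j * w a - u a * w j) *
        (∏ i ∈ S.erase j, (u i * w j - u j * w i))⁻¹) := by
      rw [Finset.mul_sum, Finset.mul_sum, Finset.mul_sum, ← Finset.sum_sub_distrib]
      apply Finset.sum_congr rfl
      intro j _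
      ring
    rw [this, ka, kb]; ring

theorem prod_erase_split (g : ℕ → K) (m p : ℕ) :
    ∏ i ∈ (range (m + 1 + p)).erase m, g i =
      (∏ i ∈ range m, g i) * ∏ i ∈ range p, g (m + 1 + i) := by
  induction p with
  | zero => simp [Finset.range_add_one]
  | succ p ih =>
    rw [prod_range_succ, ← mul_assoc, ← ih, ← add_assoc, Finset.range_add_one (n := m + 1 + p),
      Finset.erase_insert_of_ne (by omega), Finset.prod_insert (by simp)]
    ring

/-- Solutions of the recurrence are determined by the Casoratian. -/
theorem cas_eq (q x s : K) (hq : q ≠ 0) (u w : ℤ → K)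
    (hu : ∀ n, u (n + 2) = x * u (n + 1) + q ^ n * s * u n)
    (hw : ∀ n, w (n + 2) = x * w (n + 1) + q ^ n * s * w n) (l : ℤ) (i : ℕ) :
    u (l + i) * w l - u l * w (l + i) =
      (u (l + 1) * w l - u l * w (l + 1)) * qFib q x (q ^ l * s) (i : ℤ) := by
  rw [qFib_nat]
  induction i using Nat.twoStepInduction with
  | zero => simp [qFibPos, mul_comm]
  | one => simp [qFibPos]
  | more i h1 h2 =>
    have e1 : l + ((i + 2 : ℕ) : ℤ) = (l + i) + 2 := by push_cast; ring
    have e2 : l + ((i + 1 : ℕ) : ℤ) = (l + i) + 1 := by push_cast; ring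
    rw [e2] at h2
    rw [e1, hu, hw, qFibPos, zpow_add₀ hq, zpow_natCast]
    linear_combination x * h2 + q ^ l * q ^ i * s * h1

theorem coeff_const (q s : K) (hq : q ≠ 0) (hs : s ≠ 0) (n : ℤ) (W : ℤ → K)
    (hW : ∀ b, W (b + 1) = -(q ^ b * s) * W b) (k j : ℕ) (hj : j ≤ k + 1) :
    (-1 : K) ^ ((j + 1).choose 2) * s ^ (j.choose 2) *
        q ^ ((n - 1) * (j.choose 2 : ℤ) - ∑ i ∈ Finset.range j, (i : ℤ) ^ 2) *
      (W (n - j) ^ j * ∏ i ∈ range (k + 1 - j), (-W (n - j - (i + 1)))) =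
      ∏ i ∈ range (k + 1), (-W (n - (i + 1))) := by
  induction j with
  | zero => simp
  | succ j ih =>
    rw [← ih (by omega)]
    obtain ⟨m, hm⟩ : ∃ m, k = j + m := ⟨k - j, by omega⟩
    subst hm
    have e1 : j + m + 1 - (j + 1) = m := by omega
    have e2 : j + m + 1 - j = m + 1 := by omega
    rw [e1, e2, prod_range_succ']
    have e3 : ∀ i : ℕ, n - ((j + 1 : ℕ) : ℤ) - ((i : ℤ) + 1) = n - j - (((i + 1 : ℕ) : ℤ) + 1) := by
      intro i; push_cast; ring
    simp only [e3]
    have e4 : n - (j : ℤ) - (((0 : ℕ) : ℤ) + 1) = n - ((j + 1 : ℕ) : ℤ) := by push_cast; ring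
    rw [e4]
    have e5 : W (n - j) = -(q ^ (n - 1 - j) * s) * W (n - ((j + 1 : ℕ) : ℤ)) := by
      have := hW (n - ((j + 1 : ℕ) : ℤ))
      have a1 : n - ((j + 1 : ℕ) : ℤ) + 1 = n - j := by push_cast; ring
      have a2 : n - ((j + 1 : ℕ) : ℤ) = n - 1 - j := by push_cast; ring
      rw [a1] at this
      rw [this, a2]
    rw [e5]
    generalize W (n - ((j + 1 : ℕ) : ℤ)) = V
    generalize ∏ i ∈ range m, (-W (n - j - (((i + 1 : ℕ) : ℤ) + 1))) = P
    have c1 : (j + 1 + 1).choose 2 = (j + 1).choose 2 + (j + 1) := by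
      rw [Nat.choose_succ_succ' (j + 1) 1, Nat.choose_one_right]; ring
    have c2 : (j + 1).choose 2 = j.choose 2 + j := by
      rw [Nat.choose_succ_succ' j 1, Nat.choose_one_right]; ring
    have c3 : (n - 1) * (((j + 1).choose 2 : ℕ) : ℤ) - ∑ i ∈ Finset.range (j + 1), (i : ℤ) ^ 2 =
        ((n - 1) * (j.choose 2 : ℤ) - ∑ i ∈ Finset.range j, (i : ℤ) ^ 2) + (n - 1 - j) * (j : ℤ) := by
      rw [c2, sum_range_succ]; push_cast; ring
    have c4 : s ^ ((j + 1).choose 2) = s ^ (j.choose 2) * s ^ j := by rw [c2, pow_add]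
    rw [c3, c1, c4, zpow_add₀ hq, zpow_mul, zpow_natCast, pow_add _ _ (j + 1)]
    generalize q ^ (n - 1 - (j : ℤ)) = Q
    have : (-(Q * s) * V) ^ j = (-1) ^ j * Q ^ j * s ^ j * V ^ j := by
      rw [neg_mul, neg_pow, mul_pow, mul_pow]; ring
    rw [this]
    ring

theorem qFib_pow_recurrence' (q x s : K) (hq : q ≠ 0) (hs : s ≠ 0)
    (k : ℕ) (hk : 1 ≤ k) (n : ℤ)
    (hden : ∀ j ≤ k + 1,
      (∀ i : ℕ, 1 ≤ i → i ≤ j → qFib q x (q ^ (n - j) * s) (i : ℤ) ≠ 0) ∧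
      (∀ i : ℕ, 1 ≤ i → i ≤ k + 1 - j → qFib q x (q ^ (n - i - j) * s) (i : ℤ) ≠ 0)) :
    ∑ j ∈ Finset.range (k + 2),
      (-1 : K) ^ ((j + 1).choose 2) * s ^ (j.choose 2) *
        q ^ ((n - 1) * (j.choose 2 : ℤ) - ∑ i ∈ Finset.range j, (i : ℤ) ^ 2) *
        fibo q x s n k j * qFib q x s (n - j) ^ k = 0 := by
  obtain ⟨u, hu_def⟩ : ∃ u : ℤ → K, u = fun m => qFib q x s m := ⟨_, rfl⟩
  obtain ⟨w, hw_def⟩ : ∃ w : ℤ → K, w = fun m => qFib q x (q * s) (m - 1) := ⟨_, rfl⟩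
  have hu : ∀ m, u (m + 2) = x * u (m + 1) + q ^ m * s * u m := by
    intro m; rw [hu_def]; exact qFib_rec q x s hq hs m
  have hw : ∀ m, w (m + 2) = x * w (m + 1) + q ^ m * s * w m := by
    intro m
    have := qFib_rec q x (q * s) hq (mul_ne_zero hq hs) (m - 1)
    have a1 : m - 1 + 2 = m + 2 - 1 := by ring
    have a2 : m - 1 + 1 = m + 1 - 1 := by ring
    rw [a1, a2, zpow_sub_one₀ hq] at this
    simp only [hw_def]
    rw [this]
    field_simp
  obtain ⟨W, hW_def⟩ : ∃ W : ℤ → K, W = fun b => u (b + 1) * w b - u b * w (b + 1) := ⟨_, rfl⟩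
  have hW : ∀ b, W (b + 1) = -(q ^ b * s) * W b := by
    intro b
    simp only [hW_def]
    have a1 : b + 1 + 1 = b + 2 := by ring
    rw [a1, hu, hw]; ring
  have hcas : ∀ (l : ℤ) (i : ℕ), u (l + i) * w l - u l * w (l + i) =
      W l * qFib q x (q ^ l * s) (i : ℤ) := by
    intro l i
    rw [cas_eq q x s hq u w hu hw l i, hW_def]
  have hW1 : W 1 ≠ 0 := by
    have u1 : u 1 = 1 := by rw [hu_def]; rfl
    have w1 : w 1 = 0 := by rw [hw_def]; rfl
    have w2 : w (1 + 1) = 1 := by rw [hw_def]; rfl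
    simp only [hW_def]
    rw [u1, w1, w2]; simp
  have hW0 : ∀ b, W b ≠ 0 := by
    intro b
    have hc : ∀ c : ℤ, -(q ^ c * s) ≠ 0 := fun c =>
      neg_ne_zero.mpr (mul_ne_zero (zpow_ne_zero _ hq) hs)
    refine Int.induction_on (motive := fun b => W b ≠ 0) b ?_ ?_ ?_
    · intro h
      apply hW1
      have := hW 0
      rw [h] at this
      simpa using this
    · intro i h
      rw [hW]
      exact mul_ne_zero (hc _) h
    · intro i h h'
      apply h
      have := hW (-(i : ℤ) - 1)
      rw [h', sub_add_cancel] at this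
      rw [this]
      simp
  -- determinants between points
  have hd1 : ∀ i j : ℕ, u (n - (j : ℤ)) * w (n - ((j + 1 + i : ℕ) : ℤ)) -
      u (n - ((j + 1 + i : ℕ) : ℤ)) * w (n - (j : ℤ)) =
      W (n - j - (i + 1)) * qFib q x (q ^ (n - (i + 1) - j) * s) ((i : ℤ) + 1) := by
    intro i j
    have := hcas (n - ((j + 1 + i : ℕ) : ℤ)) (i + 1)
    have a1 : n - ((j + 1 + i : ℕ) : ℤ) + ((i + 1 : ℕ) : ℤ) = n - j := by push_cast; ring
    rw [a1] at this
    rw [this]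
    have a2 : n - ((j + 1 + i : ℕ) : ℤ) = n - j - (i + 1) := by push_cast; ring
    have a3 : n - (j : ℤ) - (i + 1) = n - (i + 1) - j := by ring
    rw [a2, a3]; push_cast; rfl
  have hlt : ∀ i j : ℕ, i < j → j ≤ k + 1 →
      u (n - (i : ℤ)) * w (n - (j : ℤ)) - u (n - (j : ℤ)) * w (n - (i : ℤ)) ≠ 0 := by
    intro i j hij hj
    obtain ⟨m, rfl⟩ : ∃ m, j = i + 1 + m := ⟨j - (i + 1), by omega⟩
    rw [hd1]
    apply mul_ne_zero (hW0 _)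
    have := (hden i (by omega)).2 (m + 1) (by omega) (by omega)
    push_cast at this
    exact this
  have hL := lagrange_hom (fun j : ℕ => u (n - (j : ℤ))) (fun j : ℕ => w (n - (j : ℤ))) k
    (range (k + 2)) (by simp) (by
      intro i hi j hj hij
      simp only [mem_range] at hi hj
      rcases lt_or_gt_of_ne hij with h | h
      · exact hlt i j h (by omega)
      · have := hlt j i h (by omega)
        intro h0
        apply this
        linear_combination -h0)
  obtain ⟨N, hN⟩ : ∃ N, N = ∏ i ∈ Finset.range (k + 1),
    qFib q x (q ^ (n - (i + 1)) * s) ((i : ℤ) + 1) := ⟨_, rfl⟩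
  obtain ⟨C, hC⟩ : ∃ C, C = ∏ i ∈ range (k + 1), (-W (n - (i + 1))) := ⟨_, rfl⟩
  have hterm : ∀ j ∈ range (k + 2),
      (-1 : K) ^ ((j + 1).choose 2) * s ^ (j.choose 2) *
        q ^ ((n - 1) * (j.choose 2 : ℤ) - ∑ i ∈ Finset.range j, (i : ℤ) ^ 2) *
        fibo q x s n k j * qFib q x s (n - j) ^ k =
      (C * N) * (u (n - (j : ℤ)) ^ k * (∏ i ∈ (range (k + 2)).erase j,
        (u (n - (i : ℤ)) * w (n - (j : ℤ)) - u (n - (j : ℤ)) * w (n - (i : ℤ))))⁻¹) := by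
    intro j hj
    have hj' : j ≤ k + 1 := by simp only [mem_range] at hj; omega
    have hcc := coeff_const q s hq hs n W hW k j hj'
    rw [← hC] at hcc
    have hsplit : k + 2 = j + 1 + (k + 1 - j) := by omega
    rw [hsplit, prod_erase_split]
    have hp1 : ∏ i ∈ range j, (u (n - (i : ℤ)) * w (n - (j : ℤ)) -
        u (n - (j : ℤ)) * w (n - (i : ℤ))) = W (n - j) ^ j *
        ∏ i ∈ Finset.range j, qFib q x (q ^ (n - j) * s) ((i : ℤ) + 1) := by
      rw [← Finset.prod_range_reflect]
      conv_lhs => rw [Finset.prod_congr rfl (g := fun i : ℕ => W (n - j) *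
        qFib q x (q ^ (n - (j : ℤ)) * s) ((i : ℤ) + 1)) (by
          intro i hi
          have hi' : i < j := mem_range.mp hi
          have := hcas (n - j) (i + 1)
          have a1 : n - (j : ℤ) + ((i + 1 : ℕ) : ℤ) = n - ((j - 1 - i : ℕ) : ℤ) := by
            rw [show j - 1 - i = j - (i + 1) by omega, Nat.cast_sub (by omega)]; ring
          rw [a1] at this
          rw [this]; push_cast; rfl)]
      rw [Finset.prod_mul_distrib, Finset.prod_const, card_range]
    have hp2 : ∏ i ∈ range (k + 1 - j), (u (n - ((j + 1 + i : ℕ) : ℤ)) * w (n - (j : ℤ)) -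
        u (n - (j : ℤ)) * w (n - ((j + 1 + i : ℕ) : ℤ))) =
        (∏ i ∈ range (k + 1 - j), (-W (n - j - (i + 1)))) *
        ∏ i ∈ Finset.range (k + 1 - j),
          qFib q x (q ^ (n - (i + 1) - j) * s) ((i : ℤ) + 1) := by
      rw [← Finset.prod_mul_distrib]
      apply Finset.prod_congr rfl
      intro i _
      linear_combination -(hd1 i j)
    rw [hp1, hp2, ← hcc, fibo, ← hN, hu_def]
    have hA : W (n - j) ^ j ≠ 0 := pow_ne_zero _ (hW0 _)
    have hB : ∏ i ∈ range (k + 1 - j), (-W (n - j - (i + 1))) ≠ 0 :=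
      Finset.prod_ne_zero_iff.mpr fun i _ => neg_ne_zero.mpr (hW0 _)
    rw [div_eq_mul_inv]
    simp only [mul_inv]
    generalize W (n - j) ^ j = A at *
    generalize ∏ i ∈ range (k + 1 - j), (-W (n - j - (i + 1))) = B at *
    generalize (∏ i ∈ Finset.range j, qFib q x (q ^ (n - (j : ℤ)) * s) ((i : ℤ) + 1))⁻¹ = E1
    generalize (∏ i ∈ Finset.range (k + 1 - j),
          qFib q x (q ^ (n - ((i : ℤ) + 1) - j) * s) ((i : ℤ) + 1))⁻¹ = E2
    generalize q ^ ((n - 1) * (j.choose 2 : ℤ) - ∑ i ∈ Finset.range j, (i : ℤ) ^ 2) = Q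
    field_simp
  rw [Finset.sum_congr rfl hterm, ← Finset.mul_sum]
  exact mul_eq_zero_of_right _ hL
end

section
/- (Theorem 3) For all integers k, ℓ ≥ 1 and every n ∈ ℤ, ∑_{j=0}^{k+1} (−1)^{j + ℓ·binom(j,2)} · s^{ℓ·binom(j,2)} · q^{ℓ·binom(j,2)·((4j+1)ℓ−3)/6} · ⟨k+1, j⟩(x,s,q,ℓ) · f(n−j·ℓ, x, q^{j·ℓ}·s)^k = 0, provided all factors in the denominators of the coefficients ⟨k+1, j⟩(x,s,q,ℓ), 0 ≤ j ≤ k+1, are nonzero; here ℓ·binom(j,2)·((4j+1)ℓ−3)/6 is an integer. -/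
open Finset

variable {K : Type*} [Field K]

/-- The ℓ-th q-fibonomial coefficient `⟨k, j⟩(x,s,q,ℓ) = (∏_{i=1}^{k} f(iℓ,x,s)) /
(∏_{i=1}^{j} f(iℓ,x,q^{(j-i)ℓ}s) · ∏_{i=1}^{k-j} f(iℓ,x,q^{jℓ}s))`. -/
noncomputable def qFibonomialL (q x s : K) (ℓ k j : ℕ) : K :=
  (∏ i ∈ Finset.range k, qFib q x s (((i + 1) * ℓ : ℕ))) /
    ((∏ i ∈ Finset.range j, qFib q x (q ^ ((j - (i + 1)) * ℓ) * s) (((i + 1) * ℓ : ℕ))) *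
      (∏ i ∈ Finset.range (k - j), qFib q x (q ^ (j * ℓ) * s) (((i + 1) * ℓ : ℕ))))

theorem aux_T_succ (m : ℤ) : (m + 1) * (m + 1 - 1) / 2 = m * (m - 1) / 2 + m := by
  have : (m + 1) * (m + 1 - 1) = m * (m - 1) + m * 2 := by ring
  rw [this, Int.add_mul_ediv_right _ _ (by norm_num)]

theorem aux_two_T (m : ℤ) : 2 * (m * (m - 1) / 2) = m * (m - 1) := by
  apply Int.mul_ediv_cancel'
  have := Int.even_mul_pred_self m
  exact this.two_dvd

noncomputable def auxC (q s : K) (m : ℤ) : K := (-s) ^ m * q ^ (m * (m - 1) / 2)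

theorem auxC_ne (q s : K) (hq : q ≠ 0) (hs : s ≠ 0) (m : ℤ) : auxC q s m ≠ 0 :=
  mul_ne_zero (zpow_ne_zero _ (neg_ne_zero.2 hs)) (zpow_ne_zero _ hq)

theorem auxC_succ (q s : K) (hq : q ≠ 0) (hs : s ≠ 0) (m : ℤ) :
    auxC q s (m + 1) = -(q ^ m * s) * auxC q s m := by
  unfold auxC
  rw [aux_T_succ, zpow_add₀ hq, zpow_add₀ (neg_ne_zero.2 hs), zpow_one]
  ring

theorem aux_casorati (q s x : K) (hq : q ≠ 0) (hs : s ≠ 0) (y z : ℤ → K)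
    (hy : ∀ n, y (n + 2) = x * y (n + 1) + q ^ n * s * y n)
    (hz : ∀ n, z (n + 2) = x * z (n + 1) + q ^ n * s * z n) (n m : ℤ) :
    (y n * z (n + 1) - y (n + 1) * z n) * auxC q s m =
      (y m * z (m + 1) - y (m + 1) * z m) * auxC q s n := by
  have key : ∀ n, (y n * z (n + 1) - y (n + 1) * z n) =
      (y 0 * z (0 + 1) - y (0 + 1) * z 0) * auxC q s n := by
    have step : ∀ n, (y (n + 1) * z (n + 1 + 1) - y (n + 1 + 1) * z (n + 1)) =
        -(q ^ n * s) * (y n * z (n + 1) - y (n + 1) * z n) := by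
      intro n
      rw [show n + 1 + 1 = n + 2 by ring, hy, hz]
      ring
    intro n
    induction n using Int.induction_on with
    | zero => simp [auxC]
    | succ i ih =>
      rw [step, ih, auxC_succ q s hq hs]; ring
    | pred i ih =>
      have h1 := step (-(i : ℤ) - 1)
      have h2 := auxC_succ q s hq hs (-(i : ℤ) - 1)
      rw [sub_add_cancel] at h1 h2
      have hne : -(q ^ (-(i : ℤ) - 1) * s) ≠ 0 := neg_ne_zero.2 (mul_ne_zero (zpow_ne_zero _ hq) hs)
      apply mul_left_cancel₀ hne
      rw [sub_add_cancel, ← h1, ih, h2]; ring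
  rw [key n, key m]; ring

theorem aux_E (q s : K) (hq : q ≠ 0) (hs : s ≠ 0) (ℓ j : ℕ) :
    ((-1 : K) ^ (ℓ * j.choose 2) * s ^ (ℓ * j.choose 2) *
        q ^ ((ℓ * j.choose 2 * ((4 * j + 1) * ℓ - 3) : ℤ) / 6)) *
      ∏ i ∈ range j, auxC q s ((i + 1 : ℕ) * ℓ) = auxC q s (j * ℓ) ^ j := by
  induction j with
  | zero => simp
  | succ j ih =>
    rw [prod_range_succ, pow_succ, ← mul_assoc]
    congr 1
    have hc := pow_ne_zero j (auxC_ne q s hq hs (j * ℓ))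
    apply mul_left_cancel₀ hc
    rw [mul_comm _ (auxC q s (↑(j + 1) * ↑ℓ) ^ j)]
    nth_rewrite 2 [← ih]
    have hch : ((j + 1).choose 2) = j.choose 2 + j := by
      rw [Nat.choose_succ_succ' j 1]; simp [add_comm]
    have hch2 : 2 * ((j.choose 2 : ℕ) : ℤ) = j * (j - 1) := by
      induction j with
      | zero => simp
      | succ j _ =>
        rw [Nat.choose_two_right]
        have := aux_two_T (j + 1)
        push_cast
        simpa using this
    have hexp : ((ℓ * (j + 1).choose 2 * ((4 * (j + 1 : ℕ) + 1) * ℓ - 3) : ℤ) / 6) =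
        ((ℓ * j.choose 2 * ((4 * j + 1) * ℓ - 3) : ℤ) / 6) +
        j * ((((j + 1 : ℕ) : ℤ) * ℓ) * (((j + 1 : ℕ) : ℤ) * ℓ - 1) / 2 -
          ((j : ℤ) * ℓ) * ((j : ℤ) * ℓ - 1) / 2) := by
      rw [← Int.add_mul_ediv_right _ _ (by norm_num : (6 : ℤ) ≠ 0)]
      congr 1
      have t1 := aux_two_T (((j + 1 : ℕ) : ℤ) * ℓ)
      have t2 := aux_two_T ((j : ℤ) * ℓ)
      rw [hch]
      push_cast at *
      linear_combination (-3 * (j : ℤ)) * (t1 - t2) + 2 * ((ℓ : ℤ) ^ 2) * hch2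
    rw [hexp, hch, zpow_add₀ hq, zpow_mul' q (j : ℤ), zpow_natCast, zpow_sub₀ hq]
    unfold auxC
    have e2 : (-s) ^ (((j + 1 : ℕ) : ℤ) * ℓ) = (-s) ^ ((j : ℤ) * ℓ) * (-s) ^ ℓ := by
      rw [← zpow_natCast (-s) ℓ, ← zpow_add₀ (neg_ne_zero.2 hs)]; congr 1; push_cast; ring
    have e3 : ∀ a : ℕ, (-1 : K) ^ a * s ^ a = (-s) ^ a := by
      intro a; rw [← mul_pow]; simp
    rw [e2, e3, e3, mul_add, pow_add, pow_mul _ ℓ j]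
    have h1 := zpow_ne_zero (((j : ℤ) * ℓ) * ((j : ℤ) * ℓ - 1) / 2) hq
    have h2 := pow_ne_zero j h1
    simp only [mul_pow, div_pow]
    field_simp

theorem aux_prod (g : ℕ → K) (j r : ℕ) :
    ∏ i ∈ (range (j + r + 1)).erase j, g i =
      (∏ i ∈ range j, g i) * ∏ i ∈ range r, g (j + 1 + i) := by
  have h : ∏ i ∈ (range (j + r + 1)).erase j, g i =
      ∏ i ∈ range (j + 1 + r), Function.update g j 1 i := by
    rw [← Finset.mul_prod_erase (range (j + 1 + r)) _ (mem_range.2 (by omega : j < j + 1 + r))]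
    rw [Function.update_self, one_mul, show j + r + 1 = j + 1 + r by ring]
    apply prod_congr rfl
    intro i hi
    rw [Function.update_of_ne (ne_of_mem_erase hi)]
  rw [h, prod_range_add, prod_range_succ, Function.update_self, mul_one]
  congr 1
  · apply prod_congr rfl
    intro i hi
    rw [Function.update_of_ne (by have := mem_range.1 hi; omega)]
  · apply prod_congr rfl
    intro i hi
    rw [Function.update_of_ne (by omega)]

theorem aux_lagrange (S : Finset ℕ) (r : ℕ → K) (hr : Set.InjOn r S) (hS : 2 ≤ S.card) :
    ∑ j ∈ S, 1 / ∏ i ∈ S.erase j, (r j - r i) = 0 := by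
  have h := Lagrange.coeff_eq_sum (P := (1 : Polynomial K)) hr
    (by rw [Polynomial.degree_one]; exact_mod_cast (by omega : 0 < S.card))
  rw [Polynomial.coeff_one, if_neg (by omega)] at h
  simpa using h.symm

theorem aux_H2 (S : Finset ℕ) (u w : ℕ → K) (m : ℕ) (hS : S.card = m + 2)
    (hu : ∀ i ∈ S, u i ≠ 0)
    (hD : ∀ i ∈ S, ∀ j ∈ S, i ≠ j → u i * w j - w i * u j ≠ 0) :
    ∑ j ∈ S, u j ^ m / ∏ i ∈ S.erase j, (u i * w j - w i * u j) = 0 := by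
  have hr : Set.InjOn (fun i => w i / u i) S := by
    intro i hi j hj h
    by_contra hne
    apply hD i hi j hj hne
    have h1 := hu i hi
    have h2 := hu j hj
    simp only at h
    rw [div_eq_div_iff h1 h2] at h
    rw [h]; ring
  have hL := aux_lagrange S (fun i => w i / u i) hr (by omega)
  have hterm : ∀ j ∈ S, u j ^ m / ∏ i ∈ S.erase j, (u i * w j - w i * u j) =
      (∏ i ∈ S, u i)⁻¹ * (1 / ∏ i ∈ S.erase j, (w j / u j - w i / u i)) := by
    intro j hj
    have hj' := hu j hj
    have h1 : ∏ i ∈ S.erase j, (u i * w j - w i * u j) =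
        (∏ i ∈ S.erase j, u i) * u j ^ (m + 1) * ∏ i ∈ S.erase j, (w j / u j - w i / u i) := by
      rw [show m + 1 = (S.erase j).card by rw [card_erase_of_mem hj]; omega, ← prod_const,
        ← prod_mul_distrib, ← prod_mul_distrib]
      apply prod_congr rfl
      intro i hi
      have hi' := hu i (mem_of_mem_erase hi)
      field_simp
    rw [h1, ← Finset.mul_prod_erase S u hj, pow_succ, one_div, div_eq_mul_inv]
    have h3 := pow_ne_zero m hj'
    simp only [mul_inv]
    field_simp
  rw [sum_congr rfl hterm, ← mul_sum, hL, mul_zero]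

theorem aux_H (S : Finset ℕ) (u w : ℕ → K) (k : ℕ) (hk : 1 ≤ k) (hS : S.card = k + 2)
    (hD : ∀ i ∈ S, ∀ j ∈ S, i ≠ j → u i * w j - w i * u j ≠ 0) :
    ∑ j ∈ S, u j ^ k / ∏ i ∈ S.erase j, (u i * w j - w i * u j) = 0 := by
  by_cases hu : ∀ i ∈ S, u i ≠ 0
  · exact aux_H2 S u w k hS hu hD
  push Not at hu
  obtain ⟨a, ha, hua⟩ := hu
  obtain ⟨m, rfl⟩ : ∃ m, k = m + 1 := ⟨k - 1, by omega⟩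
  have h2 := aux_H2 (S.erase a) u w m (by rw [card_erase_of_mem ha]; omega)
    (by
      intro i hi h0
      exact hD i (mem_of_mem_erase hi) a ha (ne_of_mem_erase hi) (by rw [h0, hua]; ring))
    (fun i hi j hj => hD i (mem_of_mem_erase hi) j (mem_of_mem_erase hj))
  rw [← Finset.add_sum_erase S _ ha, hua, zero_pow (by omega), zero_div, zero_add]
  have hterm : ∀ j ∈ S.erase a, u j ^ (m + 1) / ∏ i ∈ S.erase j, (u i * w j - w i * u j) =
      (-w a)⁻¹ * (u j ^ m / ∏ i ∈ (S.erase a).erase j, (u i * w j - w i * u j)) := by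
    intro j hj
    have hja := ne_of_mem_erase hj
    have hd := hD a ha j (mem_of_mem_erase hj) hja.symm
    rw [hua] at hd
    have huj : u j ≠ 0 := by
      intro h; apply hd; rw [h]; ring
    rw [← Finset.mul_prod_erase (S.erase j) _ (mem_erase.2 ⟨hja.symm, ha⟩), hua,
      Finset.erase_right_comm, pow_succ, zero_mul, zero_sub, div_eq_mul_inv, div_eq_mul_inv,
      mul_inv, ← neg_mul, mul_inv]
    generalize (∏ i ∈ (S.erase a).erase j, (u i * w j - w i * u j)) = P
    field_simp
  rw [sum_congr rfl hterm, ← mul_sum, h2, mul_zero]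

theorem qFib_pow_recurrence_ell (q x s : K) (hq : q ≠ 0) (hs : s ≠ 0)
    (k ℓ : ℕ) (hk : 1 ≤ k) (hℓ : 1 ≤ ℓ) (n : ℤ)
    (hden : ∀ j ≤ k + 1,
      (∀ i, 1 ≤ i → i ≤ j → qFib q x (q ^ ((j - i) * ℓ) * s) ((i * ℓ : ℕ)) ≠ 0) ∧
      (∀ i, 1 ≤ i → i ≤ k + 1 - j → qFib q x (q ^ (j * ℓ) * s) ((i * ℓ : ℕ)) ≠ 0)) :
    ∑ j ∈ Finset.range (k + 2),
      (-1 : K) ^ (j + ℓ * j.choose 2) * s ^ (ℓ * j.choose 2) *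
        q ^ ((ℓ * j.choose 2 * ((4 * j + 1) * ℓ - 3) : ℤ) / 6) *
        qFibonomialL q x s ℓ (k + 1) j *
        qFib q x (q ^ (j * ℓ) * s) (n - j * ℓ) ^ k = 0 := by
  set y : ℕ → ℤ → K := fun j m => qFib q x (q ^ (j * ℓ) * s) (m - j * ℓ) with hy
  have hyrec : ∀ j m, y j (m + 2) = x * y j (m + 1) + q ^ m * s * y j m := by
    intro j m
    have h := qFib_rec q x (q ^ (j * ℓ) * s) hq (mul_ne_zero (pow_ne_zero _ hq) hs) (m - j * ℓ)
    simp only [hy]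
    rw [show m + 2 - (j : ℤ) * ℓ = m - j * ℓ + 2 by ring,
      show m + 1 - (j : ℤ) * ℓ = m - j * ℓ + 1 by ring, h, ← mul_assoc (q ^ (m - (j : ℤ) * ℓ)),
      ← zpow_natCast q (j * ℓ), ← zpow_add₀ hq]
    push_cast
    rw [sub_add_cancel]
  have hy0 : ∀ j, y j (j * ℓ) = 0 := by
    intro j; simp only [hy, sub_self]; rfl
  have hy1 : ∀ j, y j (j * ℓ + 1) = 1 := by
    intro j; simp only [hy, add_sub_cancel_left]; rfl
  have hC := auxC_ne q s hq hs
  have hlt : ∀ i j, y i n * y j (n + 1) - y i (n + 1) * y j n =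
      auxC q s n * y i (j * ℓ) / auxC q s (j * ℓ) := by
    intro i j
    have h := aux_casorati q s x hq hs (y i) (y j) (hyrec i) (hyrec j) n (j * ℓ)
    rw [hy0, hy1] at h
    rw [eq_div_iff (hC _), h]; ring
  have hgt : ∀ i j, y i n * y j (n + 1) - y i (n + 1) * y j n =
      -(auxC q s n * y j (i * ℓ) / auxC q s (i * ℓ)) := by
    intro i j
    rw [← hlt j i]; ring
  have hyval : ∀ i d, y i ((i + d : ℕ) * ℓ) = qFib q x (q ^ (i * ℓ) * s) ((d * ℓ : ℕ)) := by
    intro i d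
    simp only [hy]; congr 1; push_cast; ring
  have hyne : ∀ i j, i < j → j ≤ k + 1 → y i (j * ℓ) ≠ 0 := by
    intro i j hij hj
    obtain ⟨d, rfl⟩ := Nat.exists_eq_add_of_lt hij
    have := (hden i (by omega)).2 (d + 1) (by omega) (by omega)
    rw [← hyval] at this
    exact this
  have hD : ∀ i ∈ range (k + 2), ∀ j ∈ range (k + 2), i ≠ j →
      y i n * y j (n + 1) - y i (n + 1) * y j n ≠ 0 := by
    intro i hi j hj hij
    rw [mem_range] at hi hj
    rcases lt_or_gt_of_ne hij with h | h
    · rw [hlt]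
      exact div_ne_zero (mul_ne_zero (hC _) (hyne i j h (by omega))) (hC _)
    · rw [hgt]
      exact neg_ne_zero.2 (div_ne_zero (mul_ne_zero (hC _) (hyne j i h (by omega))) (hC _))
  have hH := aux_H (range (k + 2)) (fun i => y i n) (fun i => y i (n + 1)) k hk (card_range _) hD
  have hterm : ∀ j ∈ range (k + 2),
      (-1 : K) ^ (j + ℓ * j.choose 2) * s ^ (ℓ * j.choose 2) *
        q ^ ((ℓ * j.choose 2 * ((4 * j + 1) * ℓ - 3) : ℤ) / 6) *
        qFibonomialL q x s ℓ (k + 1) j *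
        qFib q x (q ^ (j * ℓ) * s) (n - j * ℓ) ^ k =
      ((∏ i ∈ Finset.range (k + 1), qFib q x s (((i + 1) * ℓ : ℕ))) * auxC q s n ^ (k + 1) *
        (-1) ^ (k + 1) / ∏ i ∈ range (k + 1), auxC q s ((i + 1 : ℕ) * ℓ)) *
      (y j n ^ k / ∏ i ∈ (range (k + 2)).erase j,
        (y i n * y j (n + 1) - y i (n + 1) * y j n)) := by
    intro j hj
    rw [mem_range] at hj
    obtain ⟨r, hr⟩ : ∃ r, k + 1 = j + r := ⟨k + 1 - j, by omega⟩
    have hE := aux_E q s hq hs ℓ j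
    have hA : ∏ i ∈ range j, qFib q x (q ^ ((j - (i + 1)) * ℓ) * s) (((i + 1) * ℓ : ℕ)) =
        ∏ i ∈ range j, y i (j * ℓ) := by
      rw [← prod_range_reflect]
      apply prod_congr rfl
      intro i hi
      rw [mem_range] at hi
      have h := hyval i (j - i)
      rw [show i + (j - i) = j by omega] at h
      rw [h, show j - 1 - i + 1 = j - i by omega, show j - (j - i) = i by omega]
    have hB : ∏ i ∈ range (k + 1 - j), qFib q x (q ^ (j * ℓ) * s) (((i + 1) * ℓ : ℕ)) =
        ∏ i ∈ range r, y j ((j + 1 + i : ℕ) * ℓ) := by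
      rw [show k + 1 - j = r by omega]
      apply prod_congr rfl
      intro i hi
      rw [← hyval j (i + 1), show j + (i + 1) = j + 1 + i by ring]
    have hA0 : ∏ i ∈ range j, y i (j * ℓ) ≠ 0 :=
      prod_ne_zero_iff.2 fun i hi => hyne i j (mem_range.1 hi) (by omega)
    have hB0 : ∏ i ∈ range r, y j ((j + 1 + i : ℕ) * ℓ) ≠ 0 :=
      prod_ne_zero_iff.2 fun i hi => hyne j (j + 1 + i) (by omega)
        (by have := mem_range.1 hi; omega)
    have hP : ∏ i ∈ (range (k + 2)).erase j, (y i n * y j (n + 1) - y i (n + 1) * y j n) =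
        (auxC q s n ^ j * (∏ i ∈ range j, y i (j * ℓ)) / auxC q s (j * ℓ) ^ j) *
        ((-1) ^ r * (auxC q s n ^ r * (∏ i ∈ range r, y j ((j + 1 + i : ℕ) * ℓ)) /
          ∏ i ∈ range r, auxC q s ((j + 1 + i : ℕ) * ℓ))) := by
      rw [show k + 2 = j + r + 1 by omega, aux_prod]
      congr 1
      · rw [prod_congr rfl (fun i _ => hlt i j), prod_div_distrib, prod_mul_distrib]
        simp
      · rw [prod_congr rfl (fun i _ => hgt (j + 1 + i) j), Finset.prod_neg, prod_div_distrib,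
          prod_mul_distrib]
        simp
    have hCC : ∏ i ∈ range (k + 1), auxC q s ((i + 1 : ℕ) * ℓ) =
        (∏ i ∈ range j, auxC q s ((i + 1 : ℕ) * ℓ)) *
          ∏ i ∈ range r, auxC q s ((j + 1 + i : ℕ) * ℓ) := by
      rw [hr, prod_range_add]
      congr 1
      apply prod_congr rfl
      intro i _
      rw [show j + i + 1 = j + 1 + i by ring]
    have hC1 : ∏ i ∈ range j, auxC q s ((i + 1 : ℕ) * ℓ) ≠ 0 :=
      prod_ne_zero_iff.2 fun i hi => hC _
    have hC2 : ∏ i ∈ range r, auxC q s ((j + 1 + i : ℕ) * ℓ) ≠ 0 :=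
      prod_ne_zero_iff.2 fun i hi => hC _
    have hyj : qFib q x (q ^ (j * ℓ) * s) (n - j * ℓ) = y j n := rfl
    rw [hyj, hP, hCC, qFibonomialL, hA, hB]
    generalize (∏ i ∈ Finset.range (k + 1), qFib q x s (((i + 1) * ℓ : ℕ))) = N
    rw [hr, pow_add (-1 : K) j r, pow_add (-1 : K) j, pow_add (auxC q s n)]
    have hcn := hC n
    have hcj := pow_ne_zero j (hC (j * ℓ))
    rw [← hE] at hcj ⊢
    generalize (∏ i ∈ range j, auxC q s ((i + 1 : ℕ) * ℓ)) = C1 at *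
    generalize (∏ i ∈ range r, auxC q s ((j + 1 + i : ℕ) * ℓ)) = C2 at *
    generalize (∏ i ∈ range j, y i (j * ℓ)) = A at *
    generalize (∏ i ∈ range r, y j ((j + 1 + i : ℕ) * ℓ)) = B at *
    generalize q ^ ((ℓ * j.choose 2 * ((4 * j + 1) * ℓ - 3) : ℤ) / 6) = Q at *
    generalize (-1 : K) ^ (ℓ * j.choose 2) = M at *
    generalize s ^ (ℓ * j.choose 2) = Z at *
    have hm : (-1 : K) ^ r ≠ 0 := pow_ne_zero _ (by simp)
    generalize (-1 : K) ^ r = R at *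
    have hcnj := pow_ne_zero j hcn
    have hcnr := pow_ne_zero r hcn
    generalize auxC q s n ^ j = U at *
    generalize auxC q s n ^ r = V at *
    field_simp
  rw [sum_congr rfl hterm, ← mul_sum, hH, mul_zero]
end
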